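/- Let φ be a Full Modal Team Logic formula and (M,X) a team model over a set Prop of propositional variables containing the free variables of φ. If (M,X) ⊨ ∃̃p φ, then there exists a team model (K,Z) such that (K,Z) ⇌_{Prop∖{p}} (M,X) and (K,Z) ⊨ φ. -/

import Mathlib

/-- A Kripke model `M = (W, R, V)` over a set `V` of propositional letters. -/
structure KModel (V : Type) : Type 1 where
  W : Type
  R : W → W → Prop
  val : W → V → Prop

variable {V : Type}

/-- `B` is a `P`-bisimulation between the Kripke models `M` and `N`:
related points agree on all propositions of `P`, and `B` satisfies the
forth and back conditions. -/
def IsBisim (P : Set V) (M N : KModel V) (B : M.W → N.W → Prop) : Prop :=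
  (∀ w v, B w v → ∀ p ∈ P, (M.val w p ↔ N.val v p)) ∧
  (∀ w v, B w v → ∀ w', M.R w w' → ∃ v', N.R v v' ∧ B w' v') ∧
  (∀ w v, B w v → ∀ v', N.R v v' → ∃ w', M.R w w' ∧ B w' v')

/-- `(M,w) ⇌_P (N,v)`: some `P`-bisimulation relates `w` and `v`. -/
def Bisimilar (P : Set V) (M : KModel V) (w : M.W) (N : KModel V) (v : N.W) : Prop :=
  ∃ B, IsBisim P M N B ∧ B w v

/-- Team `P`-bisimulation `(M,X) ⇌_P (N,Y)`: every point of `X` is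
`P`-bisimilar to some point of `Y` and conversely. -/
def TeamBisim (P : Set V) (M : KModel V) (X : Set M.W) (N : KModel V) (Y : Set N.W) : Prop :=
  (∀ x ∈ X, ∃ y ∈ Y, Bisimilar P M x N y) ∧
  (∀ y ∈ Y, ∃ x ∈ X, Bisimilar P M x N y)

/-- Formulas of Full Modal Team Logic: literals, `⊥`, `NE`, `∧`, `⊗`, `∨`,
`◇`, `□`. -/
inductive MForm (V : Type) : Type where
  | var : V → MForm V
  | nvar : V → MForm V
  | bot : MForm V
  | ne : MForm V
  | and : MForm V → MForm V → MForm V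
  | tens : MForm V → MForm V → MForm V
  | or : MForm V → MForm V → MForm V
  | dia : MForm V → MForm V
  | box : MForm V → MForm V

/-- `R(X) = {t : ∃ s ∈ X, sRt}`. -/
def KModel.img (M : KModel V) (X : Set M.W) : Set M.W := {t | ∃ s ∈ X, M.R s t}

/-- `X R Y`: every point of `X` has an `R`-successor in `Y` and every point
of `Y` has an `R`-predecessor in `X`. -/
def teamR (M : KModel V) (X Y : Set M.W) : Prop :=
  (∀ x ∈ X, ∃ y ∈ Y, M.R x y) ∧ (∀ y ∈ Y, ∃ x ∈ X, M.R x y)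

/-- Modal team semantics of Full Modal Team Logic. -/
def MSat (M : KModel V) : Set M.W → MForm V → Prop
  | X, .var p => ∀ s ∈ X, M.val s p
  | X, .nvar p => ∀ s ∈ X, ¬ M.val s p
  | X, .bot => X = ∅
  | X, .ne => X ≠ ∅
  | X, .and φ ψ => MSat M X φ ∧ MSat M X ψ
  | X, .tens φ ψ => ∃ X₁ X₂, X = X₁ ∪ X₂ ∧ MSat M X₁ φ ∧ MSat M X₂ ψ
  | X, .or φ ψ => MSat M X φ ∨ MSat M X ψ
  | X, .dia φ => ∃ Y, teamR M X Y ∧ MSat M Y φ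
  | X, .box φ => MSat M (M.img X) φ

/-- The set `L(φ)` of propositional letters occurring in `φ` (these are
exactly the free variables of an `FMTL` formula). -/
def mletters : MForm V → Set V
  | .var p => {p}
  | .nvar p => {p}
  | .bot => ∅
  | .ne => ∅
  | .and φ ψ => mletters φ ∪ mletters ψ
  | .tens φ ψ => mletters φ ∪ mletters ψ
  | .or φ ψ => mletters φ ∪ mletters ψ
  | .dia φ => mletters φ
  | .box φ => mletters φ

theorem isBisim_bisimilar (P : Set V) (M N : KModel V) :
    IsBisim P M N (fun w v => Bisimilar P M w N v) := by
  refine ⟨?_, ?_, ?_⟩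
  · rintro w v ⟨B, hB, hwv⟩
    exact hB.1 w v hwv
  · rintro w v ⟨B, hB, hwv⟩ w' hw'
    obtain ⟨v', hv', hb⟩ := hB.2.1 w v hwv w' hw'
    exact ⟨v', hv', B, hB, hb⟩
  · rintro w v ⟨B, hB, hwv⟩ v' hv'
    obtain ⟨w', hw', hb⟩ := hB.2.2 w v hwv v' hv'
    exact ⟨w', hw', B, hB, hb⟩

theorem Bisimilar.mono {P Q : Set V} (hPQ : P ⊆ Q) {M N : KModel V} {w : M.W} {v : N.W}
    (h : Bisimilar Q M w N v) : Bisimilar P M w N v := by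
  obtain ⟨B, hB, hwv⟩ := h
  exact ⟨B, ⟨fun w v hb q hq => hB.1 w v hb q (hPQ hq), hB.2⟩, hwv⟩

theorem TeamBisim.mono {P Q : Set V} (hPQ : P ⊆ Q) {M N : KModel V} {X : Set M.W} {Y : Set N.W}
    (h : TeamBisim Q M X N Y) : TeamBisim P M X N Y :=
  ⟨fun x hx => (h.1 x hx).imp fun _ hy => ⟨hy.1, hy.2.mono hPQ⟩,
    fun y hy => (h.2 y hy).imp fun _ hx => ⟨hx.1, hx.2.mono hPQ⟩⟩

/-- A subteam of `X` is team bisimilar to the set of points of `Y` bisimilar to one of its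
members. -/
theorem TeamBisim.restrict {P : Set V} {M N : KModel V} {X X₁ : Set M.W} {Y : Set N.W}
    (h : TeamBisim P M X N Y) (hX₁ : X₁ ⊆ X) :
    TeamBisim P M X₁ N {y ∈ Y | ∃ x ∈ X₁, Bisimilar P M x N y} := by
  refine ⟨fun x hx => ?_, fun y hy => hy.2⟩
  obtain ⟨y, hy, hb⟩ := h.1 x (hX₁ hx)
  exact ⟨y, ⟨hy, x, hx, hb⟩, hb⟩

theorem TeamBisim.img {P : Set V} {M N : KModel V} {X : Set M.W} {Y : Set N.W}
    (h : TeamBisim P M X N Y) : TeamBisim P M (M.img X) N (N.img Y) := by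
  constructor
  · rintro t ⟨s, hs, hst⟩
    obtain ⟨y, hy, hb⟩ := h.1 s hs
    obtain ⟨u, hu, hb'⟩ := (isBisim_bisimilar P M N).2.1 s y hb t hst
    exact ⟨u, ⟨y, hy, hu⟩, hb'⟩
  · rintro u ⟨y, hy, hyu⟩
    obtain ⟨s, hs, hb⟩ := h.2 y hy
    obtain ⟨t, ht, hb'⟩ := (isBisim_bisimilar P M N).2.2 s y hb u hyu
    exact ⟨t, ⟨s, hs, ht⟩, hb'⟩

theorem TeamBisim.exists_teamR {P : Set V} {M N : KModel V} {X X₁ : Set M.W} {Y : Set N.W}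
    (h : TeamBisim P M X N Y) (hR : teamR M X X₁) :
    ∃ Y₁, teamR N Y Y₁ ∧ TeamBisim P M X₁ N Y₁ := by
  refine ⟨{y ∈ N.img Y | ∃ x ∈ X₁, Bisimilar P M x N y}, ⟨fun y hy => ?_, fun y hy => hy.1⟩,
    h.img.restrict fun t ht => hR.2 t ht⟩
  obtain ⟨x, hx, hb⟩ := h.2 y hy
  obtain ⟨t, ht, hxt⟩ := hR.1 x hx
  obtain ⟨u, hu, hb'⟩ := (isBisim_bisimilar P M N).2.1 x y hb t hxt
  exact ⟨u, ⟨⟨y, hy, hu⟩, t, ht, hb'⟩, hu⟩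

theorem TeamBisim.eq_empty {P : Set V} {M N : KModel V} {X : Set M.W} {Y : Set N.W}
    (h : TeamBisim P M X N Y) (hX : X = ∅) : Y = ∅ := by
  refine Set.eq_empty_of_forall_notMem fun y hy => ?_
  obtain ⟨x, hx, -⟩ := h.2 y hy
  simp [hX] at hx

theorem TeamBisim.ne_empty {P : Set V} {M N : KModel V} {X : Set M.W} {Y : Set N.W}
    (h : TeamBisim P M X N Y) (hX : X ≠ ∅) : Y ≠ ∅ := by
  obtain ⟨x, hx⟩ := Set.nonempty_iff_ne_empty.2 hX
  obtain ⟨y, hy, -⟩ := h.1 x hx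
  exact Set.nonempty_iff_ne_empty.1 ⟨y, hy⟩

/-- Formulas are invariant under team bisimulation for the letters occurring in them. -/
theorem TeamBisim.msat {M N : KModel V} {φ : MForm V} {X : Set M.W} {Y : Set N.W}
    (h : TeamBisim (mletters φ) M X N Y) (hX : MSat M X φ) : MSat N Y φ := by
  induction φ generalizing X Y with
  | var q =>
    intro y hy
    obtain ⟨x, hx, hb⟩ := h.2 y hy
    exact ((isBisim_bisimilar _ M N).1 x y hb q rfl).1 (hX x hx)
  | nvar q =>
    intro y hy hq
    obtain ⟨x, hx, hb⟩ := h.2 y hy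
    exact hX x hx (((isBisim_bisimilar _ M N).1 x y hb q rfl).2 hq)
  | bot => exact h.eq_empty hX
  | ne => exact h.ne_empty hX
  | and φ ψ ihφ ihψ =>
    exact ⟨ihφ (h.mono Set.subset_union_left) hX.1, ihψ (h.mono Set.subset_union_right) hX.2⟩
  | tens φ ψ ihφ ihψ =>
    obtain ⟨X₁, X₂, rfl, h₁, h₂⟩ := hX
    refine ⟨_, _, ?_,
      ihφ ((h.restrict Set.subset_union_left).mono Set.subset_union_left) h₁,
      ihψ ((h.restrict Set.subset_union_right).mono Set.subset_union_right) h₂⟩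
    ext y
    constructor
    · intro hy
      obtain ⟨x, hx | hx, hb⟩ := h.2 y hy
      · exact Or.inl ⟨hy, x, hx, hb⟩
      · exact Or.inr ⟨hy, x, hx, hb⟩
    · rintro (hy | hy) <;> exact hy.1
  | or φ ψ ihφ ihψ =>
    exact hX.imp (ihφ (h.mono Set.subset_union_left)) (ihψ (h.mono Set.subset_union_right))
  | dia φ ih =>
    obtain ⟨X₁, hR, h₁⟩ := hX
    obtain ⟨Y₁, hR', hb⟩ := h.exists_teamR hR
    exact ⟨Y₁, hR', ih hb h₁⟩
  | box φ ih => exact ih h.img hX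

/-- The amalgam of `M` and `N`: pairs of `P`-bisimilar points, with the letters in `L` evaluated
in `M` and all other letters evaluated in `N`. -/
def KModel.amalgam (P L : Set V) (M N : KModel V) : KModel V where
  W := {w : M.W × N.W // Bisimilar P M w.1 N w.2}
  R w v := M.R w.1.1 v.1.1 ∧ N.R w.1.2 v.1.2
  val w q := (q ∈ L ∧ M.val w.1.1 q) ∨ (q ∉ L ∧ N.val w.1.2 q)

theorem bisimilar_amalgam_fst (P L : Set V) (M N : KModel V) (w : (M.amalgam P L N).W) :
    Bisimilar L M w.1.1 (M.amalgam P L N) w := by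
  refine ⟨fun x z => z.1.1 = x, ⟨?_, ?_, ?_⟩, rfl⟩
  · rintro _ z rfl q hq
    simp [KModel.amalgam, hq]
  · rintro _ z rfl x' hx'
    obtain ⟨y', hy', hb⟩ := (isBisim_bisimilar P M N).2.1 _ _ z.2 x' hx'
    exact ⟨⟨(x', y'), hb⟩, ⟨hx', hy'⟩, rfl⟩
  · rintro _ z rfl z' hz'
    exact ⟨_, hz'.1, rfl⟩

theorem bisimilar_amalgam_snd {P L Q : Set V} (hQ : Q ∩ L ⊆ P) (M N : KModel V)
    (w : (M.amalgam P L N).W) : Bisimilar Q (M.amalgam P L N) w N w.1.2 := by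
  refine ⟨fun z y => z.1.2 = y, ⟨?_, ?_, ?_⟩, rfl⟩
  · rintro z _ rfl q hq
    by_cases hL : q ∈ L
    · have hval := (isBisim_bisimilar P M N).1 _ _ z.2 q (hQ ⟨hq, hL⟩)
      simp [KModel.amalgam, hL, hval]
    · simp [KModel.amalgam, hL]
  · rintro z _ rfl z' hz'
    exact ⟨_, hz'.2, rfl⟩
  · rintro z _ rfl y' hy'
    obtain ⟨x', hx', hb⟩ := (isBisim_bisimilar P M N).2.2 _ _ z.2 y' hy'
    exact ⟨⟨(x', y'), hb⟩, ⟨hx', hy'⟩, rfl⟩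

/-- if `(M,X)` is a team model over a set `Props` of letters
containing the free variables of the `FMTL` formula `φ` and
`(M,X) ⊨ ∃̃p φ`, then there is `(K,Z)` with `(K,Z) ⇌_{Props \ {p}} (M,X)`
and `(K,Z) ⊨ φ`. -/
theorem exq_global {V : Type} (φ : MForm V) (p : V) (Props : Set V)
    (hfree : mletters φ ⊆ Props) (M : KModel V) (X : Set M.W)
    (h : ∃ (M' : KModel V) (X' : Set M'.W),
      TeamBisim (mletters φ \ {p}) M' X' M X ∧ MSat M' X' φ) :
    ∃ (K : KModel V) (Z : Set K.W),
      TeamBisim (Props \ {p}) K Z M X ∧ MSat K Z φ := by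
  obtain ⟨M', X', hb, hsat⟩ := h
  have hQ : (Props \ {p}) ∩ mletters φ ⊆ mletters φ \ {p} := fun q hq => ⟨hq.2, hq.1.2⟩
  refine ⟨M'.amalgam (mletters φ \ {p}) (mletters φ) M, {z | z.1.1 ∈ X' ∧ z.1.2 ∈ X},
    ⟨fun z hz => ⟨_, hz.2, bisimilar_amalgam_snd hQ M' M z⟩,
      fun x hx => ?_⟩,
    TeamBisim.msat ⟨fun x' hx' => ?_,
      fun z hz => ⟨_, hz.1, bisimilar_amalgam_fst _ _ M' M z⟩⟩ hsat⟩
  · obtain ⟨x', hx', hxx⟩ := hb.2 x hx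
    exact ⟨⟨(x', x), hxx⟩, ⟨hx', hx⟩,
      bisimilar_amalgam_snd hQ M' M ⟨(x', x), hxx⟩⟩
  · obtain ⟨x, hx, hxx⟩ := hb.1 x' hx'
    exact ⟨⟨(x', x), hxx⟩, ⟨hx', hx⟩, bisimilar_amalgam_fst _ _ M' M ⟨(x', x), hxx⟩⟩
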